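/- Let n ≥ 2, 0 < α ≤ n and β > 0. Suppose there is a constant C > 0 such that for every finite Borel measure μ on ℝⁿ supported in B(0,4) with [μ]_α < ∞ and every R > 1 one has ∫_{S^{n−1}} |μ̂(Rω)|² dσ(ω) ≤ C μ(ℝⁿ) [μ]_α R^{−β}, where σ is the surface measure on the unit sphere S^{n−1}. Then for every s > (n−1−β)/2 there is a constant C' > 0 such that for every even finite Borel measure μ on ℝⁿ supported in B(0,4) with [μ]_α < ∞ and every real-valued even Schwartz function f on ℝⁿ one has ∫_ℝ ∫_{ℝⁿ} |cos(t√(−Δ) − (n−1)π/4)f(x)|² dμ(x) dt ≤ C' [μ]_α ‖f‖²_{H^s}. -/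

import Mathlib

open MeasureTheory Real Metric
open scoped ENNReal RealInnerProductSpace

noncomputable section

abbrev E (n : ℕ) : Type := EuclideanSpace ℝ (Fin n)

/-- The Frostman constant `[μ]_α = sup_{x,r>0} μ(B(x,r))/r^α`. -/
def frostman {d : ℕ} (μ : Measure (E d)) (α : ℝ) : ℝ≥0∞ :=
  ⨆ (x : E d) (r : ℝ) (_ : 0 < r), μ (Metric.ball x r) / ENNReal.ofReal (r ^ α)

/-- The Fourier transform `f̂(ξ) = ∫ e^{-2πi x·ξ} f(x) dx`. -/
def FT {n : ℕ} (f : E n → ℂ) (ξ : E n) : ℂ :=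
  ∫ x, Complex.exp (((-2 * π * ⟪x, ξ⟫ : ℝ) : ℂ) * Complex.I) * f x

/-- The Sobolev norm `‖f‖_{H^s} = (∫ (1+|ξ|²)^s |f̂(ξ)|² dξ)^{1/2}`. -/
def sobolevNorm {n : ℕ} (f : E n → ℂ) (s : ℝ) : ℝ :=
  (∫ ξ : E n, (1 + ‖ξ‖ ^ 2) ^ s * ‖FT f ξ‖ ^ 2) ^ (1/2 : ℝ)

/-- The operator `cos(t√(-Δ) - (n-1)π/4)` applied to `f`. -/
def cosWave (n : ℕ) (f : E n → ℂ) (t : ℝ) (x : E n) : ℂ :=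
  ∫ ξ : E n, ((Real.cos (2 * π * t * ‖ξ‖ - ((n : ℝ) - 1) * π / 4) : ℝ) : ℂ) *
    Complex.exp (((2 * π * ⟪x, ξ⟫ : ℝ) : ℂ) * Complex.I) * FT f ξ

/-- The Fourier transform of a measure, `μ̂(ξ) = ∫ e^{-2πi x·ξ} dμ(x)`. -/
def measFT {d : ℕ} (μ : Measure (E d)) (ξ : E d) : ℂ :=
  ∫ x, Complex.exp (((-2 * π * ⟪x, ξ⟫ : ℝ) : ℂ) * Complex.I) ∂μ

open FourierTransform in
/-- The integral Fourier transform of `f ∈ L¹ ∩ L²` represents its `L²` Fourier transform. -/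
lemma fourier_toLp_ae_eq {f : ℝ → ℂ} (hf : Integrable f) (hf2 : MemLp f 2) :
    ((𝓕 (hf2.toLp f) : Lp ℂ 2 (volume : Measure ℝ)) : ℝ → ℂ) =ᵐ[volume] 𝓕 f := by
  have hcont : Continuous (𝓕 f) :=
    VectorFourier.fourierIntegral_continuous Real.continuous_fourierChar
      (by exact continuous_inner) hf
  have hloc : LocallyIntegrable
      ((𝓕 (hf2.toLp f) : Lp ℂ 2 (volume : Measure ℝ)) : ℝ → ℂ) volume :=
    (Lp.memLp (𝓕 (hf2.toLp f) : Lp ℂ 2 (volume : Measure ℝ))).locallyIntegrable (by norm_num)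
  refine ae_eq_of_integral_contDiff_smul_eq hloc hcont.locallyIntegrable fun g hg hgc => ?_
  have hg₁ : HasCompactSupport (Complex.ofRealCLM ∘ g) := hgc.comp_left rfl
  have hg₂ : ContDiff ℝ (⊤ : ℕ∞) (Complex.ofRealCLM ∘ g) :=
    Complex.ofRealCLM.contDiff.comp hg
  have h1 := congrArg (fun T => T (hg₁.toSchwartzMap hg₂))
    (Lp.fourier_toTemperedDistribution_eq (hf2.toLp f))
  simp only [TemperedDistribution.fourier_apply, Lp.toTemperedDistribution_apply] at h1
  have h2 : ∫ x, g x • 𝓕 f x = ∫ x, (hg₁.toSchwartzMap hg₂) x • 𝓕 f x := by simp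
  have h3 : ∫ x, g x • ((𝓕 (hf2.toLp f) : Lp ℂ 2 (volume : Measure ℝ)) : ℝ → ℂ) x
      = ∫ x, (hg₁.toSchwartzMap hg₂) x •
        ((𝓕 (hf2.toLp f) : Lp ℂ 2 (volume : Measure ℝ)) : ℝ → ℂ) x := by simp
  rw [h2, h3, ← h1]
  have h4 := VectorFourier.integral_fourierIntegral_smul_eq_flip (L := innerₗ ℝ)
    (μ := (volume : Measure ℝ)) (ν := (volume : Measure ℝ)) (e := Real.fourierChar)
    Real.continuous_fourierChar (by exact continuous_inner)
    (hg₁.toSchwartzMap hg₂).integrable hf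
  refine Eq.trans ?_ (h4.trans ?_)
  · refine integral_congr_ae ?_
    filter_upwards [hf2.coeFn_toLp] with x hx
    rw [hx]; rfl
  · rw [flip_innerₗ]; rfl

open FourierTransform in
/-- Plancherel's inequality for integrable functions. -/
lemma lintegral_fourier_sq_le {f : ℝ → ℂ} (hf : Integrable f) :
    ∫⁻ t, ‖𝓕 f t‖ₑ ^ 2 ≤ ∫⁻ r, ‖f r‖ₑ ^ 2 := by
  by_cases hf2 : MemLp f 2
  · have h := Lp.norm_fourier_eq (hf2.toLp f)
    rw [Lp.norm_def, Lp.norm_def, eLpNorm_congr_ae (fourier_toLp_ae_eq hf hf2),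
      eLpNorm_congr_ae hf2.coeFn_toLp] at h
    have hF : MemLp (𝓕 f) 2 (volume : Measure ℝ) :=
      (memLp_congr_ae (fourier_toLp_ae_eq hf hf2)).1 (Lp.memLp _)
    have h' := (ENNReal.toReal_eq_toReal_iff' hF.2.ne hf2.2.ne).1 h
    have key : ∀ u : ℝ → ℂ, ∫⁻ t, ‖u t‖ₑ ^ 2 = eLpNorm u 2 volume ^ 2 := fun u => by
      have := eLpNorm_nnreal_pow_eq_lintegral (f := u) (μ := (volume : Measure ℝ))
        (p := 2) (by norm_num)
      simpa using this.symm
    rw [key, key, h']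
  · have : ∫⁻ r, ‖f r‖ₑ ^ 2 = ⊤ := by
      by_contra hne
      refine hf2 ⟨hf.aestronglyMeasurable, ?_⟩
      have := eLpNorm_nnreal_pow_eq_lintegral (f := f) (μ := (volume : Measure ℝ))
        (p := 2) (by norm_num)
      by_contra htop
      rw [not_lt, top_le_iff] at htop
      simp only [ENNReal.coe_ofNat, htop] at this
      apply hne
      simpa using this.symm
    rw [this]
    exact le_top

/-- Integration in polar coordinates, for the lower Lebesgue integral. -/
lemma lintegral_polar {n : ℕ} (hn : 0 < n) {f : E n → ℝ≥0∞} (hf : Measurable f) :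
    ∫⁻ x, f x = ∫⁻ r in Set.Ioi (0 : ℝ), ENNReal.ofReal (r ^ (n - 1)) *
      ∫⁻ ω : sphere (0 : E n) 1, f (r • (ω : E n)) ∂(volume : Measure (E n)).toSphere := by
  have : Nonempty (Fin n) := ⟨⟨0, hn⟩⟩
  have hmeas : Measurable fun p : sphere (0 : E n) 1 × Set.Ioi (0 : ℝ) =>
      f ((p.2 : ℝ) • (p.1 : E n)) := hf.comp (by fun_prop)
  have hmp := (volume : Measure (E n)).measurePreserving_homeomorphUnitSphereProd
  calc ∫⁻ x, f x = ∫⁻ x : ({0}ᶜ : Set (E n)), f x ∂((volume : Measure (E n)).comap (↑)) := by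
        rw [lintegral_subtype_comap (measurableSet_singleton _).compl, restrict_compl_singleton]
    _ = ∫⁻ p : sphere (0 : E n) 1 × Set.Ioi (0 : ℝ), f ((p.2 : ℝ) • (p.1 : E n))
          ∂((volume : Measure (E n)).toSphere.prod (.volumeIoiPow (n - 1))) := by
        rw [finrank_euclideanSpace_fin] at hmp
        rw [← hmp.lintegral_comp hmeas]
        refine lintegral_congr fun x => ?_
        have hx : ‖(x : E n)‖ ≠ 0 := norm_ne_zero_iff.2 x.2
        simp [smul_smul, mul_inv_cancel₀ hx]
    _ = ∫⁻ r : Set.Ioi (0 : ℝ), ∫⁻ ω : sphere (0 : E n) 1, f ((r : ℝ) • (ω : E n))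
          ∂(volume : Measure (E n)).toSphere ∂(.volumeIoiPow (n - 1)) :=
        lintegral_prod_symm' _ hmeas
    _ = _ := by
        have hm : Measurable fun r : Set.Ioi (0 : ℝ) => ∫⁻ ω : sphere (0 : E n) 1,
            f ((r : ℝ) • (ω : E n)) ∂(volume : Measure (E n)).toSphere :=
          hmeas.lintegral_prod_left'
        rw [Measure.volumeIoiPow, lintegral_withDensity_eq_lintegral_mul _ (by fun_prop) hm]
        exact lintegral_subtype_comap measurableSet_Ioi fun r : ℝ => ENNReal.ofReal (r ^ (n - 1)) *
          ∫⁻ ω : sphere (0 : E n) 1, f (r • (ω : E n)) ∂(volume : Measure (E n)).toSphere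

/-- The radial measure `r ^ (n - 1) dr` on `(0, ∞)`. -/
def radialMeasure (n : ℕ) : Measure ℝ :=
  (volume.restrict (Set.Ioi (0 : ℝ))).withDensity fun r => ENNReal.ofReal (r ^ (n - 1))

instance (n : ℕ) : SFinite (radialMeasure n) := by
  unfold radialMeasure; infer_instance

lemma lintegral_radialMeasure (n : ℕ) {f : ℝ → ℝ≥0∞} (hf : Measurable f) :
    ∫⁻ r, f r ∂radialMeasure n = ∫⁻ r in Set.Ioi (0 : ℝ), ENNReal.ofReal (r ^ (n - 1)) * f r := by
  rw [radialMeasure, lintegral_withDensity_eq_lintegral_mul _ (by fun_prop) hf]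
  rfl

lemma integral_radialMeasure (n : ℕ) (f : ℝ → ℂ) :
    ∫ r, f r ∂radialMeasure n = ∫ r in Set.Ioi (0 : ℝ), ((r ^ (n - 1) : ℝ) : ℂ) * f r := by
  rw [radialMeasure, integral_withDensity_eq_integral_toReal_smul (by fun_prop) (by simp)]
  refine setIntegral_congr_fun measurableSet_Ioi fun r (hr : 0 < r) => ?_
  simp [ENNReal.toReal_ofReal (pow_nonneg hr.le _)]

lemma measurePreserving_polar {n : ℕ} (hn : 0 < n) :
    MeasurePreserving (fun p : ℝ × sphere (0 : E n) 1 => p.1 • (p.2 : E n))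
      ((radialMeasure n).prod (volume : Measure (E n)).toSphere) volume := by
  have hm : Measurable fun p : ℝ × sphere (0 : E n) 1 => p.1 • (p.2 : E n) := by fun_prop
  refine ⟨hm, Measure.ext_of_lintegral _ fun f hf => ?_⟩
  have hfm : Measurable fun p : ℝ × sphere (0 : E n) 1 => f (p.1 • (p.2 : E n)) := hf.comp hm
  rw [lintegral_map hf hm, lintegral_prod _ hfm.aemeasurable, lintegral_polar hn hf,
    lintegral_radialMeasure n hfm.lintegral_prod_right']

/-- A weak-type bound for a bounded function implies an `L²` bound, by interpolating the weak-type
bound with the trivial bound on the measure of superlevel sets. -/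
lemma lintegral_sq_le_of_weak {X : Type*} [MeasurableSpace X] (μ : Measure X) [IsFiniteMeasure μ]
    {v : X → ℝ} (hv : Measurable v) (hv0 : ∀ x, 0 ≤ v x) {L A B δ : ℝ} (hL : 0 ≤ L)
    (hvL : ∀ x, v x ≤ L) (hA : μ.real Set.univ ≤ A) (hδ0 : 0 < δ) (hδ1 : δ ≤ 1)
    (hB : ∀ t, 0 < t → t ^ 2 * μ.real {x | t < v x} ≤ B) :
    ∫⁻ x, ENNReal.ofReal (v x ^ 2) ∂μ ≤
      ENNReal.ofReal (A ^ δ * B ^ (1 - δ) * (L ^ 2) ^ δ / δ) := by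
  have hA0 : 0 ≤ A := measureReal_nonneg.trans hA
  have hB0 : 0 ≤ B := le_trans (by positivity) (hB 1 one_pos)
  have hlc := lintegral_rpow_eq_lintegral_meas_lt_mul μ (f := v) (.of_forall hv0)
    hv.aemeasurable (p := 2) two_pos
  simp only [Real.rpow_two] at hlc
  rw [hlc]
  have hpt : ∀ t ∈ Set.Ioi (0 : ℝ), μ {a | t < v a} * ENNReal.ofReal (t ^ ((2 : ℝ) - 1)) ≤
      (Set.Ioc 0 L).indicator
        (fun t => ENNReal.ofReal (A ^ δ * B ^ (1 - δ) * t ^ (2 * δ - 1))) t := by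
    intro t ht
    rw [Set.mem_Ioi] at ht
    by_cases htL : t ≤ L
    · rw [Set.indicator_of_mem (Set.mem_Ioc.2 ⟨ht, htL⟩), ← ofReal_measureReal,
        ← ENNReal.ofReal_mul measureReal_nonneg]
      apply ENNReal.ofReal_le_ofReal
      set m := μ.real {a | t < v a}
      have hm0 : 0 ≤ m := measureReal_nonneg
      have hmA : m ≤ A := (measureReal_mono (Set.subset_univ _)).trans hA
      have hmB : m ≤ B / t ^ 2 := by
        rw [le_div_iff₀ (by positivity), mul_comm]; exact hB t ht
      have hsplit : m = m ^ δ * m ^ (1 - δ) := by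
        rw [← Real.rpow_add_of_nonneg hm0 hδ0.le (by linarith)]; simp
      calc m * t ^ ((2 : ℝ) - 1) ≤ (A ^ δ * (B / t ^ 2) ^ (1 - δ)) * t ^ ((2 : ℝ) - 1) := by
            gcongr
            rw [hsplit]
            gcongr
        _ = A ^ δ * B ^ (1 - δ) * t ^ (2 * δ - 1) := by
            rw [Real.div_rpow hB0 (by positivity), ← Real.rpow_natCast_mul ht.le, mul_div_assoc',
              div_mul_eq_mul_div, mul_div_assoc, ← Real.rpow_sub ht]
            congr 2; push_cast; ring
    · rw [Set.indicator_of_notMem (by simp [htL])]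
      have : {a | t < v a} = ∅ := by
        ext a; simpa using (hvL a).trans (not_le.1 htL).le
      simp [this]
  have hint : ∫⁻ t in Set.Ioi (0 : ℝ), (Set.Ioc 0 L).indicator
      (fun t => ENNReal.ofReal (A ^ δ * B ^ (1 - δ) * t ^ (2 * δ - 1))) t =
      ENNReal.ofReal (A ^ δ * B ^ (1 - δ) * ((L ^ 2) ^ δ / (2 * δ))) := by
    rw [setLIntegral_indicator measurableSet_Ioc,
      Set.inter_eq_self_of_subset_left Set.Ioc_subset_Ioi_self,
      ← ofReal_integral_eq_lintegral_ofReal, integral_const_mul,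
      ← intervalIntegral.integral_of_le hL, integral_rpow (Or.inl (by linarith))]
    · congr 3
      rw [sub_add_cancel, Real.zero_rpow (by positivity), sub_zero, ← Real.rpow_natCast_mul hL]
      norm_num
      ring
    · refine Integrable.const_mul ?_ _
      have := intervalIntegral.intervalIntegrable_rpow' (a := 0) (b := L) (r := 2 * δ - 1)
        (by linarith)
      exact (intervalIntegrable_iff_integrableOn_Ioc_of_le hL).1 this
    · refine (ae_restrict_iff' measurableSet_Ioc).2 (.of_forall fun t ht => ?_)
      have := ht.1
      simp only [Pi.zero_apply]
      positivity
  calc _ ≤ ENNReal.ofReal 2 * ∫⁻ t in Set.Ioi (0 : ℝ), (Set.Ioc 0 L).indicator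
          (fun t => ENNReal.ofReal (A ^ δ * B ^ (1 - δ) * t ^ (2 * δ - 1))) t := by
        gcongr 1
        exact setLIntegral_mono' measurableSet_Ioi hpt
    _ = _ := by
        rw [hint, ← ENNReal.ofReal_mul two_pos.le]
        congr 1
        field_simp

lemma frostman_restrict_le {n : ℕ} (μ : Measure (E n)) (α : ℝ) (A : Set (E n)) :
    frostman (μ.restrict A) α ≤ frostman μ α := by
  unfold frostman
  gcongr
  exact Measure.restrict_le_self

lemma measureReal_univ_le_frostman {n : ℕ} (μ : Measure (E n)) {α : ℝ}
    (hμ : μ (Metric.ball (0 : E n) 4)ᶜ = 0) (hfin : frostman μ α < ⊤) :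
    μ.real Set.univ ≤ 4 ^ α * (frostman μ α).toReal := by
  have h4 : (0 : ℝ) < 4 ^ α := by positivity
  have h1 : μ (ball (0 : E n) 4) / ENNReal.ofReal (4 ^ α) ≤ frostman μ α := by
    unfold frostman
    exact le_iSup_of_le 0 (le_iSup_of_le 4 (le_iSup_of_le four_pos le_rfl))
  have h2 : μ Set.univ ≤ frostman μ α * ENNReal.ofReal (4 ^ α) := by
    rw [← measure_add_measure_compl (s := ball (0 : E n) 4) measurableSet_ball, hμ, add_zero]
    exact (ENNReal.div_le_iff (by simpa using h4) ENNReal.ofReal_ne_top).1 h1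
  have h3 := ENNReal.toReal_mono (ENNReal.mul_ne_top hfin.ne ENNReal.ofReal_ne_top) h2
  rw [ENNReal.toReal_mul, ENNReal.toReal_ofReal h4.le] at h3
  rw [measureReal_def]
  linarith

/-- The extension operator on the sphere of radius `R`, applied to a density `h`. -/
def sphereExt {n : ℕ} (R : ℝ) (h : sphere (0 : E n) 1 → ℂ) (x : E n) : ℂ :=
  ∫ ω : sphere (0 : E n) 1, Complex.exp (((2 * π * ⟪x, R • (ω : E n)⟫ : ℝ) : ℂ) * Complex.I) * h ω
    ∂(volume : Measure (E n)).toSphere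

lemma norm_exp_two_pi_inner {n : ℕ} (x ξ : E n) :
    ‖Complex.exp (((2 * π * ⟪x, ξ⟫ : ℝ) : ℂ) * Complex.I)‖ = 1 :=
  Complex.norm_exp_ofReal_mul_I _

lemma measurable_sphereExt {n : ℕ} {g : E n → ℂ} (hg : Continuous g) :
    Measurable fun p : ℝ × E n => sphereExt p.1 (fun ω => g (p.1 • (ω : E n))) p.2 := by
  unfold sphereExt
  refine (StronglyMeasurable.integral_prod_right'
    (f := fun q : (ℝ × E n) × sphere (0 : E n) 1 =>
      Complex.exp (((2 * π * ⟪q.1.2, q.1.1 • (q.2 : E n)⟫ : ℝ) : ℂ) * Complex.I) *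
        g (q.1.1 • (q.2 : E n))) ?_).measurable
  exact Continuous.stronglyMeasurable (by fun_prop)

lemma integrable_sphere {n : ℕ} {F : Type*} [NormedAddCommGroup F]
    {h : sphere (0 : E n) 1 → F} (hh : Continuous h) :
    Integrable h (volume : Measure (E n)).toSphere := by
  have := hh.continuousOn.integrableOn_compact (μ := (volume : Measure (E n)).toSphere)
    (isCompact_univ (X := sphere (0 : E n) 1))
  simpa using this

lemma sq_integral_mul_le {X : Type*} [MeasurableSpace X] {ν : Measure X} {u v : X → ℝ}
    (hu : ∀ x, 0 ≤ u x) (hv : ∀ x, 0 ≤ v x) (hu2 : MemLp u 2 ν) (hv2 : MemLp v 2 ν) :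
    (∫ x, u x * v x ∂ν) ^ 2 ≤ (∫ x, u x ^ 2 ∂ν) * ∫ x, v x ^ 2 ∂ν := by
  have h := integral_mul_le_Lp_mul_Lq_of_nonneg (μ := ν) Real.HolderConjugate.two_two
    (.of_forall hu) (.of_forall hv) (by simpa using hu2) (by simpa using hv2)
  simp only [Real.rpow_two] at h
  have hu0 : 0 ≤ ∫ x, u x ^ 2 ∂ν := integral_nonneg fun x => sq_nonneg _
  have hv0 : 0 ≤ ∫ x, v x ^ 2 ∂ν := integral_nonneg fun x => sq_nonneg _
  rw [← Real.sqrt_eq_rpow, ← Real.sqrt_eq_rpow] at h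
  calc _ ≤ (√(∫ x, u x ^ 2 ∂ν) * √(∫ x, v x ^ 2 ∂ν)) ^ 2 :=
        pow_le_pow_left₀ (integral_nonneg fun x => mul_nonneg (hu x) (hv x)) h 2
    _ = _ := by rw [mul_pow, Real.sq_sqrt hu0, Real.sq_sqrt hv0]

lemma memLp_two_sphere {n : ℕ} {F : Type*} [NormedAddCommGroup F]
    {h : sphere (0 : E n) 1 → F} (hh : Continuous h) :
    MemLp h 2 (volume : Measure (E n)).toSphere := by
  refine (memLp_two_iff_integrable_sq_norm (integrable_sphere hh).aestronglyMeasurable).2 ?_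
  exact integrable_sphere (by fun_prop)

lemma norm_sphereExt_sq_le {n : ℕ} (R : ℝ) {h : sphere (0 : E n) 1 → ℂ} (hh : Continuous h)
    (x : E n) : ‖sphereExt R h x‖ ^ 2 ≤ (volume : Measure (E n)).toSphere.real Set.univ *
      ∫ ω, ‖h ω‖ ^ 2 ∂(volume : Measure (E n)).toSphere := by
  have h1 : ‖sphereExt R h x‖ ≤ ∫ ω, 1 * ‖h ω‖ ∂(volume : Measure (E n)).toSphere := by
    refine (norm_integral_le_integral_norm _).trans_eq ?_
    simp only [norm_mul, norm_exp_two_pi_inner]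
  have h2 := sq_integral_mul_le (ν := (volume : Measure (E n)).toSphere)
    (u := fun _ => (1 : ℝ)) (v := fun ω => ‖h ω‖) (fun _ => zero_le_one) (fun _ => norm_nonneg _)
    (memLp_const 1) (memLp_two_sphere hh).norm
  refine (pow_le_pow_left₀ (norm_nonneg _) h1 2).trans (h2.trans_eq ?_)
  simp

lemma continuous_measFT {n : ℕ} (μ : Measure (E n)) [IsFiniteMeasure μ] :
    Continuous (measFT μ) := by
  unfold measFT
  refine continuous_of_dominated (bound := fun _ => (1 : ℝ)) (fun ξ => ?_) (fun ξ => ?_)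
    (integrable_const _) (.of_forall fun x => by fun_prop)
  · exact Continuous.aestronglyMeasurable (by fun_prop)
  · exact .of_forall fun x => (Complex.norm_exp_ofReal_mul_I _).le

/-- Duality between the extension operator and the Fourier transform of a measure. -/
lemma integral_sphereExt {n : ℕ} (ν : Measure (E n)) [IsFiniteMeasure ν] (R : ℝ)
    {h : sphere (0 : E n) 1 → ℂ} (hh : Continuous h) :
    ∫ x, sphereExt R h x ∂ν = ∫ ω : sphere (0 : E n) 1,
      (starRingEnd ℂ) (measFT ν (R • (ω : E n))) * h ω ∂(volume : Measure (E n)).toSphere := by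
  unfold sphereExt
  rw [integral_integral_swap]
  · refine integral_congr_ae (.of_forall fun ω => ?_)
    simp only
    rw [integral_mul_const, measFT, ← integral_conj]
    congr 1
    refine integral_congr_ae (.of_forall fun x => ?_)
    simp [← Complex.exp_conj, map_ofNat]
  · have h1 : Integrable (fun p : E n × sphere (0 : E n) 1 => ‖h p.2‖)
        (ν.prod (volume : Measure (E n)).toSphere) :=
      (integrable_sphere hh).norm.comp_snd ν
    refine h1.mono' (Continuous.aestronglyMeasurable (by fun_prop)) (.of_forall fun p => ?_)
    simp [Function.uncurry, -Complex.ofReal_mul]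

lemma norm_integral_sphereExt_sq_le {n : ℕ} (ν : Measure (E n)) [IsFiniteMeasure ν] (R : ℝ)
    {h : sphere (0 : E n) 1 → ℂ} (hh : Continuous h) :
    ‖∫ x, sphereExt R h x ∂ν‖ ^ 2 ≤
      (∫ ω : sphere (0 : E n) 1, ‖measFT ν (R • (ω : E n))‖ ^ 2
        ∂(volume : Measure (E n)).toSphere) *
      ∫ ω, ‖h ω‖ ^ 2 ∂(volume : Measure (E n)).toSphere := by
  have hc : Continuous fun ω : sphere (0 : E n) 1 => measFT ν (R • (ω : E n)) :=
    (continuous_measFT ν).comp (by fun_prop)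
  rw [integral_sphereExt ν R hh]
  refine (pow_le_pow_left₀ (norm_nonneg _) (norm_integral_le_integral_norm _) 2).trans ?_
  simp only [norm_mul, RCLike.norm_conj]
  exact sq_integral_mul_le (fun _ => norm_nonneg _) (fun _ => norm_nonneg _)
    (memLp_two_sphere hc).norm (memLp_two_sphere hh).norm

lemma continuous_sphereExt {n : ℕ} (R : ℝ) {h : sphere (0 : E n) 1 → ℂ} (hh : Continuous h) :
    Continuous (sphereExt R h) := by
  unfold sphereExt
  refine continuous_of_dominated (bound := fun ω => ‖h ω‖) (fun x => ?_) (fun x => ?_)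
    (integrable_sphere hh).norm (.of_forall fun ω => by fun_prop)
  · exact Continuous.aestronglyMeasurable (by fun_prop)
  · exact .of_forall fun ω => by rw [norm_mul, norm_exp_two_pi_inner, one_mul]

/-- A function whose averages over all sets `A` are controlled by `√(B * μ A)` is in weak `L²`. -/
lemma sq_mul_measureReal_le_of_integral {X : Type*} [MeasurableSpace X] (μ : Measure X)
    [IsFiniteMeasure μ] {F : X → ℂ} (hF : Measurable F) (hFi : Integrable F μ) {B : ℝ} (hB0 : 0 ≤ B)
    (hB : ∀ A, MeasurableSet A → ‖∫ x in A, F x ∂μ‖ ^ 2 ≤ B * μ.real A) {t : ℝ} (ht : 0 < t) :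
    t ^ 2 * μ.real {x | t < ‖F x‖} ≤ 16 * B := by
  have hhalf : ∀ c : ℂ, ‖c‖ = 1 → μ.real {x | t / 2 < (c * F x).re} ≤ 4 * B / t ^ 2 := by
    intro c hc
    have hmeas : MeasurableSet {x | t / 2 < (c * F x).re} :=
      measurableSet_lt measurable_const (Complex.measurable_re.comp (hF.const_mul c))
    set A := {x | t / 2 < (c * F x).re}
    have h1 : t / 2 * μ.real A ≤ ∫ x in A, (c * F x).re ∂μ := by
      refine setIntegral_ge_of_const_le_real hmeas (measure_ne_top _ _) (fun x hx => le_of_lt hx) ?_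
      exact (hFi.const_mul c).re.integrableOn
    have h2 : ∫ x in A, (c * F x).re ∂μ ≤ ‖∫ x in A, F x ∂μ‖ := by
      have : ∫ x in A, (c * F x).re ∂μ = (∫ x in A, c * F x ∂μ).re :=
        integral_re (hFi.const_mul c).integrableOn
      rw [this, integral_const_mul]
      exact (Complex.re_le_norm _).trans (by rw [norm_mul, hc, one_mul])
    have h3 : (t / 2 * μ.real A) ^ 2 ≤ B * μ.real A :=
      (pow_le_pow_left₀ (by positivity) (h1.trans h2) 2).trans (hB A hmeas)
    rw [le_div_iff₀ (by positivity)]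
    rcases (measureReal_nonneg (μ := μ) (s := A)).eq_or_lt with h0 | h0
    · rw [← h0, zero_mul]
      positivity
    · have : (t / 2) ^ 2 * μ.real A ≤ B := by
        refine le_of_mul_le_mul_right ?_ h0
        linarith [h3]
      linarith
  have hsub : {x | t < ‖F x‖} ⊆ ({x | t / 2 < (1 * F x).re} ∪ {x | t / 2 < (-1 * F x).re}) ∪
      ({x | t / 2 < (Complex.I * F x).re} ∪ {x | t / 2 < (-Complex.I * F x).re}) := by
    intro x (hx : t < ‖F x‖)
    have h := hx.trans_le (Complex.norm_le_abs_re_add_abs_im (F x))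
    by_contra hcon
    simp only [Set.mem_union, Set.mem_ofPred_eq, not_or, not_lt, Complex.mul_re, Complex.neg_re,
      Complex.neg_im, Complex.one_re, Complex.one_im, Complex.I_re, Complex.I_im] at hcon
    obtain ⟨⟨h1, h2⟩, h3, h4⟩ := hcon
    have h5 : |(F x).re| ≤ t / 2 := abs_le.2 ⟨by linarith, by linarith⟩
    have h6 : |(F x).im| ≤ t / 2 := abs_le.2 ⟨by linarith, by linarith⟩
    linarith
  have hle := (measureReal_mono (μ := μ) hsub (measure_ne_top _ _)).trans ((measureReal_union_le _ _).trans
    (add_le_add (measureReal_union_le _ _) (measureReal_union_le _ _)))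
  have h1 := hhalf 1 (by simp)
  have h2 := hhalf (-1) (by simp)
  have h3 := hhalf Complex.I (by simp)
  have h4 := hhalf (-Complex.I) (by simp)
  have h5 : μ.real {x | t < ‖F x‖} ≤ 16 * B / t ^ 2 := by
    calc _ ≤ _ := hle
      _ ≤ (4 * B / t ^ 2 + 4 * B / t ^ 2) + (4 * B / t ^ 2 + 4 * B / t ^ 2) := by gcongr
      _ = _ := by ring
  rwa [le_div_iff₀ (by positivity), mul_comm] at h5

/-- Restricted-type bounds for the Fourier transforms of the restrictions of `μ` give an `L²(μ)`
bound for the extension operator, at the cost of an arbitrarily small power. -/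
lemma lintegral_sphereExt_sq_le {n : ℕ} (μ : Measure (E n)) [IsFiniteMeasure μ] {R D M δ : ℝ}
    (hD : 0 ≤ D)
    (hdec : ∀ A, MeasurableSet A → ∫ ω : sphere (0 : E n) 1,
      ‖measFT (μ.restrict A) (R • (ω : E n))‖ ^ 2 ∂(volume : Measure (E n)).toSphere ≤
        D * μ.real A)
    (hM : μ.real Set.univ ≤ M) (hδ0 : 0 < δ) (hδ1 : δ ≤ 1)
    {h : sphere (0 : E n) 1 → ℂ} (hh : Continuous h) :
    ∫⁻ x, ‖sphereExt R h x‖ₑ ^ 2 ∂μ ≤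
      ENNReal.ofReal (M ^ δ * (16 * D) ^ (1 - δ) *
        ((volume : Measure (E n)).toSphere.real Set.univ) ^ δ / δ *
          ∫ ω, ‖h ω‖ ^ 2 ∂(volume : Measure (E n)).toSphere) := by
  set Q := ∫ ω, ‖h ω‖ ^ 2 ∂(volume : Measure (E n)).toSphere
  set S := (volume : Measure (E n)).toSphere.real Set.univ
  have hQ : 0 ≤ Q := integral_nonneg fun _ => by positivity
  have hS : 0 ≤ S := measureReal_nonneg
  have hcont := continuous_sphereExt R hh
  have hbd : ∀ x, ‖sphereExt R h x‖ ≤ √(S * Q) := fun x =>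
    Real.le_sqrt_of_sq_le (norm_sphereExt_sq_le R hh x)
  have hint : Integrable (sphereExt R h) μ :=
    Integrable.of_bound hcont.aestronglyMeasurable _ (.of_forall hbd)
  have hweak := fun t ht => sq_mul_measureReal_le_of_integral μ hcont.measurable hint
    (B := D * Q) (mul_nonneg hD hQ) (t := t) (fun A hA =>
      (norm_integral_sphereExt_sq_le (μ.restrict A) R hh).trans <| by
        calc _ ≤ D * μ.real A * Q := mul_le_mul_of_nonneg_right (hdec A hA) hQ
          _ = _ := by ring) ht
  have hmain := lintegral_sq_le_of_weak μ (v := fun x => ‖sphereExt R h x‖)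
    hcont.measurable.norm (fun _ => norm_nonneg _) (Real.sqrt_nonneg _) hbd hM hδ0 hδ1 hweak
  simp only [ENNReal.ofReal_pow (norm_nonneg _), ofReal_norm] at hmain
  refine hmain.trans_eq ?_
  congr 1
  rw [Real.sq_sqrt (by positivity), ← mul_assoc, Real.mul_rpow (by positivity) hQ,
    Real.mul_rpow hS hQ]
  have hsplit : Q = Q ^ (1 - δ) * Q ^ δ := by
    rw [← Real.rpow_add_of_nonneg hQ (by linarith) hδ0.le]; simp
  conv_rhs => rw [hsplit]
  ring

open FourierTransform in
lemma FT_eq_fourier {n : ℕ} (f : SchwartzMap (E n) ℂ) : FT (⇑f) = ⇑(𝓕 f : SchwartzMap (E n) ℂ) := by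
  funext ξ
  rw [SchwartzMap.fourier_coe, Real.fourier_eq', FT]
  simp only [smul_eq_mul]

open FourierTransform in
/-- Plancherel's inequality in time for a superposition of phase-shifted cosines. -/
lemma lintegral_cos_transform_sq_le {G : ℝ → ℂ} (hG : Integrable G) (θ : ℝ) :
    ∫⁻ t : ℝ, ‖∫ r, ((Real.cos (2 * π * t * r - θ) : ℝ) : ℂ) * G r‖ₑ ^ 2 ≤
      ∫⁻ r, ‖G r‖ₑ ^ 2 := by
  have hcont : Continuous (𝓕 G) :=
    VectorFourier.fourierIntegral_continuous Real.continuous_fourierChar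
      (by exact continuous_inner) hG
  have hexp : ∀ t, Integrable fun r => Complex.exp (((-2 * π * (r * t) : ℝ) : ℂ) * Complex.I) * G r :=
    fun t => by
      refine hG.bdd_mul (c := 1) (Continuous.aestronglyMeasurable (by fun_prop))
        (.of_forall fun r => (Complex.norm_exp_ofReal_mul_I _).le)
  have hF : ∀ t : ℝ, 𝓕 G t = ∫ r, Complex.exp (((-2 * π * (r * t) : ℝ) : ℂ) * Complex.I) * G r := by
    intro t
    rw [Real.fourier_real_eq_integral_exp_smul]
    simp only [smul_eq_mul]
    congr 1
    funext r
    congr 4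
    ring
  have hid : ∀ t : ℝ, ∫ r, ((Real.cos (2 * π * t * r - θ) : ℝ) : ℂ) * G r =
      (1 / 2 : ℂ) * (Complex.exp ((θ : ℂ) * Complex.I) * 𝓕 G t +
        Complex.exp (((-θ : ℝ) : ℂ) * Complex.I) * 𝓕 G (-t)) := by
    intro t
    rw [hF, hF, ← integral_const_mul, ← integral_const_mul, ← integral_add
      ((hexp t).const_mul _) ((hexp (-t)).const_mul _), ← integral_const_mul]
    congr 1
    funext r
    rw [Complex.ofReal_cos, Complex.cos]
    have e1 : ((2 * π * t * r - θ : ℝ) : ℂ) * Complex.I = ((-θ : ℝ) : ℂ) * Complex.I +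
      ((-2 * π * (r * -t) : ℝ) : ℂ) * Complex.I := by push_cast; ring
    have e2 : -((2 * π * t * r - θ : ℝ) : ℂ) * Complex.I = (θ : ℂ) * Complex.I +
      ((-2 * π * (r * t) : ℝ) : ℂ) * Complex.I := by push_cast; ring
    rw [e1, e2, Complex.exp_add, Complex.exp_add]
    ring
  have hpt : ∀ t : ℝ, ‖∫ r, ((Real.cos (2 * π * t * r - θ) : ℝ) : ℂ) * G r‖ₑ ^ 2 ≤
      2⁻¹ * ‖𝓕 G t‖ₑ ^ 2 + 2⁻¹ * ‖𝓕 G (-t)‖ₑ ^ 2 := by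
    intro t
    have hreal : ‖∫ r, ((Real.cos (2 * π * t * r - θ) : ℝ) : ℂ) * G r‖ ^ 2 ≤
        2⁻¹ * ‖𝓕 G t‖ ^ 2 + 2⁻¹ * ‖𝓕 G (-t)‖ ^ 2 := by
      have h1 : ‖∫ r, ((Real.cos (2 * π * t * r - θ) : ℝ) : ℂ) * G r‖ ≤
          1 / 2 * (‖𝓕 G t‖ + ‖𝓕 G (-t)‖) := by
        rw [hid, norm_mul]
        refine mul_le_mul (by simp) ((norm_add_le _ _).trans_eq ?_) (norm_nonneg _) (by norm_num)
        rw [norm_mul, norm_mul, Complex.norm_exp_ofReal_mul_I, Complex.norm_exp_ofReal_mul_I,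
          one_mul, one_mul]
      refine (pow_le_pow_left₀ (norm_nonneg _) h1 2).trans ?_
      nlinarith [sq_nonneg (‖𝓕 G t‖ - ‖𝓕 G (-t)‖)]
    have h2 := ENNReal.ofReal_le_ofReal hreal
    rw [ENNReal.ofReal_add (by positivity) (by positivity), ENNReal.ofReal_mul (by norm_num),
      ENNReal.ofReal_mul (by norm_num), ENNReal.ofReal_pow (norm_nonneg _),
      ENNReal.ofReal_pow (norm_nonneg _), ENNReal.ofReal_pow (norm_nonneg _),
      ofReal_norm, ofReal_norm, ofReal_norm, ENNReal.ofReal_inv_of_pos two_pos,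
      ENNReal.ofReal_ofNat] at h2
    exact h2
  have hm : Measurable fun t => ‖𝓕 G t‖ₑ ^ 2 := hcont.measurable.enorm.pow_const 2
  calc _ ≤ ∫⁻ t : ℝ, (2⁻¹ * ‖𝓕 G t‖ₑ ^ 2 + 2⁻¹ * ‖𝓕 G (-t)‖ₑ ^ 2) := lintegral_mono hpt
    _ = 2⁻¹ * (∫⁻ t : ℝ, ‖𝓕 G t‖ₑ ^ 2) + 2⁻¹ * ∫⁻ t : ℝ, ‖𝓕 G (-t)‖ₑ ^ 2 := by
        rw [lintegral_add_left (hm.const_mul _), lintegral_const_mul _ hm,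
          lintegral_const_mul _ (show Measurable fun t => ‖𝓕 G (-t)‖ₑ ^ 2 from hm.comp measurable_neg)]
    _ = ∫⁻ t : ℝ, ‖𝓕 G t‖ₑ ^ 2 := by
        rw [lintegral_neg_eq_self (fun t : ℝ => ‖𝓕 G t‖ₑ ^ 2), ← add_mul,
          ENNReal.inv_two_add_inv_two, one_mul]
    _ ≤ _ := lintegral_fourier_sq_le hG

/-- The polar-coordinate profile of `e^{2πi x·ξ} g(ξ)`. -/
def radialProfile {n : ℕ} (g : E n → ℂ) (x : E n) : ℝ → ℂ :=
  (Set.Ioi (0 : ℝ)).indicator fun r =>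
    ((r ^ (n - 1) : ℝ) : ℂ) * sphereExt r (fun ω => g (r • (ω : E n))) x

lemma integrable_polar {n : ℕ} (hn : 0 < n) {u : E n → ℂ} (hu : Integrable u) :
    Integrable (fun p : ℝ × sphere (0 : E n) 1 => u (p.1 • (p.2 : E n)))
      ((radialMeasure n).prod (volume : Measure (E n)).toSphere) :=
  (measurePreserving_polar hn).integrable_comp_of_integrable hu

lemma integral_polar {n : ℕ} (hn : 0 < n) {u : E n → ℂ} (hu : Integrable u) :
    ∫ x, u x = ∫ r in Set.Ioi (0 : ℝ), ((r ^ (n - 1) : ℝ) : ℂ) *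
      ∫ ω : sphere (0 : E n) 1, u (r • (ω : E n)) ∂(volume : Measure (E n)).toSphere := by
  have hp := measurePreserving_polar hn
  have h1 := integral_map hp.measurable.aemeasurable (f := u)
    (by rw [hp.map_eq]; exact hu.aestronglyMeasurable)
  rw [hp.map_eq] at h1
  rw [h1, integral_prod _ (integrable_polar hn hu), integral_radialMeasure]

lemma integrable_mul_exp {n : ℕ} {g : E n → ℂ} (hg : Integrable g) (x : E n) :
    Integrable fun ξ => Complex.exp (((2 * π * ⟪x, ξ⟫ : ℝ) : ℂ) * Complex.I) * g ξ :=
  hg.bdd_mul (c := 1) (Continuous.aestronglyMeasurable (by fun_prop))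
    (.of_forall fun ξ => (norm_exp_two_pi_inner x ξ).le)

lemma integrable_radialProfile {n : ℕ} (hn : 0 < n) {g : E n → ℂ} (hg : Integrable g) (x : E n) :
    Integrable (radialProfile g x) := by
  unfold radialProfile
  rw [integrable_indicator_iff measurableSet_Ioi, IntegrableOn]
  have h := (integrable_polar hn (integrable_mul_exp hg x)).integral_prod_left
  rw [radialMeasure, integrable_withDensity_iff_integrable_smul' (by fun_prop) (by simp)] at h
  refine h.congr ?_
  filter_upwards [ae_restrict_mem measurableSet_Ioi] with r hr
  have hr' : 0 < r := hr
  rw [ENNReal.toReal_ofReal (pow_nonneg hr'.le _), Complex.real_smul]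
  rfl

lemma cosWave_eq_radial {n : ℕ} (hn : 0 < n) (f : E n → ℂ) (hf : Integrable (FT f)) (t : ℝ)
    (x : E n) : cosWave n f t x = ∫ r, ((Real.cos (2 * π * t * r - ((n : ℝ) - 1) * π / 4) : ℝ) : ℂ) *
      radialProfile (FT f) x r := by
  have hint : Integrable fun ξ : E n =>
      ((Real.cos (2 * π * t * ‖ξ‖ - ((n : ℝ) - 1) * π / 4) : ℝ) : ℂ) *
      (Complex.exp (((2 * π * ⟪x, ξ⟫ : ℝ) : ℂ) * Complex.I) * FT f ξ) := by
    refine (integrable_mul_exp hf x).bdd_mul (c := 1)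
      (Continuous.aestronglyMeasurable (by fun_prop)) (.of_forall fun ξ => ?_)
    rw [Complex.norm_real]
    exact Real.abs_cos_le_one _
  unfold cosWave
  simp only [mul_assoc (Complex.ofReal (Real.cos _))]
  rw [integral_polar hn hint, ← integral_indicator measurableSet_Ioi]
  congr 1
  funext r
  by_cases hr : r ∈ Set.Ioi (0 : ℝ)
  · have hr' : 0 < r := hr
    simp only [radialProfile, Set.indicator_of_mem hr, sphereExt]
    rw [mul_left_comm, ← integral_const_mul (Complex.ofReal (Real.cos _))]
    congr 2
    funext ω
    simp [norm_smul, abs_of_pos hr']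
  · simp [radialProfile, Set.indicator_of_notMem hr]

lemma integrable_sobolev_density {n : ℕ} (g : SchwartzMap (E n) ℂ) (s : ℝ) :
    Integrable fun ξ : E n => (1 + ‖ξ‖ ^ 2) ^ s * ‖g ξ‖ ^ 2 := by
  have hw := Function.hasTemperateGrowth_one_add_norm_sq_rpow (E n) (s / 2)
  have h := (memLp_two_iff_integrable_sq_norm
    (SchwartzMap.smulLeftCLM ℂ (fun x : E n => (1 + ‖x‖ ^ 2) ^ (s / 2)) g).continuous.aestronglyMeasurable).1
    ((SchwartzMap.smulLeftCLM ℂ (fun x : E n => (1 + ‖x‖ ^ 2) ^ (s / 2)) g).memLp 2 volume)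
  refine h.congr (.of_forall fun ξ => ?_)
  simp only
  have h0 : (0 : ℝ) < 1 + ‖ξ‖ ^ 2 := by positivity
  rw [SchwartzMap.smulLeftCLM_apply_apply hw, norm_smul, mul_pow, Real.norm_eq_abs, sq_abs,
    ← Real.rpow_mul_natCast h0.le]
  congr 2
  push_cast
  ring

lemma rpow_max_le_mul_one_add_sq {r : ℝ} (hr : 0 < r) (s : ℝ) :
    (max 1 r) ^ (2 * s) ≤ max 1 (2 ^ (-s)) * (1 + r ^ 2) ^ s := by
  set ρ := max 1 r with hρ
  have h1 : 1 ≤ ρ := le_max_left _ _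
  have hup : ρ ^ 2 ≤ 1 + r ^ 2 := by
    rcases max_cases 1 r with h | h <;> rw [hρ, h.1] <;> nlinarith
  have hlow : 1 + r ^ 2 ≤ 2 * ρ ^ 2 := by
    have : r ≤ ρ := le_max_right _ _
    nlinarith
  have hpow : ρ ^ (2 * s) = (ρ ^ 2) ^ s := by
    rw [← Real.rpow_natCast_mul (by positivity)]; norm_num
  rw [hpow]
  rcases le_total 0 s with hs | hs
  · calc (ρ ^ 2) ^ s ≤ 1 * (1 + r ^ 2) ^ s := by rw [one_mul]; gcongr
      _ ≤ _ := by gcongr; exact le_max_left _ _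
  · calc (ρ ^ 2) ^ s = 2 ^ (-s) * (2 * ρ ^ 2) ^ s := by
          rw [Real.mul_rpow two_pos.le (by positivity), ← mul_assoc, ← Real.rpow_add two_pos]
          simp
      _ ≤ 2 ^ (-s) * (1 + r ^ 2) ^ s := by
          gcongr 2 ^ (-s) * ?_
          exact Real.rpow_le_rpow_of_nonpos (by positivity) hlow hs
      _ ≤ _ := by gcongr; exact le_max_right _ _

lemma lintegral_sphereExt_sq_le_trivial {n : ℕ} (μ : Measure (E n)) [IsFiniteMeasure μ] (R : ℝ)
    {h : sphere (0 : E n) 1 → ℂ} (hh : Continuous h) :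
    ∫⁻ x, ‖sphereExt R h x‖ₑ ^ 2 ∂μ ≤
      ENNReal.ofReal (μ.real Set.univ * ((volume : Measure (E n)).toSphere.real Set.univ *
          ∫ ω, ‖h ω‖ ^ 2 ∂(volume : Measure (E n)).toSphere)) := by
  rw [ENNReal.ofReal_mul measureReal_nonneg, ofReal_measureReal, mul_comm, ← lintegral_const]
  refine lintegral_mono fun x => ?_
  rw [← ofReal_norm, ← ENNReal.ofReal_pow (norm_nonneg _)]
  exact ENNReal.ofReal_le_ofReal (norm_sphereExt_sq_le R hh x)

/-- Spherical decay implies `L²(μ)` bounds for the extension operator at every radius. -/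
lemma exists_sphereExt_bound {n : ℕ} (hn : 0 < n) {α β C s : ℝ} (hβ : 0 < β) (hC : 0 < C)
    (H : ∀ (μ : Measure (E n)), IsFiniteMeasure μ →
        μ (Metric.ball (0 : E n) 4)ᶜ = 0 → frostman μ α < ⊤ →
        ∀ R : ℝ, 1 < R →
          (∫ ω : Metric.sphere (0 : E n) 1,
              ‖measFT μ (R • (ω : E n))‖ ^ 2 ∂(volume : Measure (E n)).toSphere) ≤
            C * (μ Set.univ).toReal * (frostman μ α).toReal * R ^ (-β))
    (hs : ((n : ℝ) - 1 - β) / 2 < s) :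
    ∃ K : ℝ, 0 < K ∧ ∀ (μ : Measure (E n)), IsFiniteMeasure μ →
      μ (Metric.ball (0 : E n) 4)ᶜ = 0 → frostman μ α < ⊤ →
      ∀ r : ℝ, 0 < r → ∀ h : sphere (0 : E n) 1 → ℂ, Continuous h →
        ENNReal.ofReal (r ^ (n - 1)) * ∫⁻ x, ‖sphereExt r h x‖ₑ ^ 2 ∂μ ≤
          ENNReal.ofReal (K * (frostman μ α).toReal * ((1 + r ^ 2) ^ s *
            ∫ ω, ‖h ω‖ ^ 2 ∂(volume : Measure (E n)).toSphere)) := by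
  set S := (volume : Measure (E n)).toSphere.real Set.univ with hSdef
  have hS : 0 ≤ S := measureReal_nonneg
  set ε := 2 * s - ((n : ℝ) - 1) + β with hε
  have hε0 : 0 < ε := by rw [hε]; linarith
  set δ := min 1 (ε / β) with hδ
  have hδ0 : 0 < δ := lt_min one_pos (by positivity)
  have hδ1 : δ ≤ 1 := min_le_left _ _
  have hδε : δ * β ≤ ε := (le_div_iff₀ hβ).1 (min_le_right _ _)
  have hcast : ((n - 1 : ℕ) : ℝ) = (n : ℝ) - 1 := by rw [Nat.cast_sub hn]; simp
  set K₁ := ((4 : ℝ) ^ α) ^ δ * (16 * C) ^ (1 - δ) * S ^ δ / δ with hK₁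
  set K₀ := (4 : ℝ) ^ α * S with hK₀
  have hK₁0 : 0 ≤ K₁ := by positivity
  have hK₀0 : 0 ≤ K₀ := by positivity
  refine ⟨(K₀ + K₁ + 1) * max 1 (2 ^ (-s)), by positivity, ?_⟩
  intro μ hμ hsupp hfin r hr h hh
  set m := (frostman μ α).toReal with hm
  have hm0 : 0 ≤ m := ENNReal.toReal_nonneg
  have hM := measureReal_univ_le_frostman μ hsupp hfin
  set Q := ∫ ω, ‖h ω‖ ^ 2 ∂(volume : Measure (E n)).toSphere
  have hQ : 0 ≤ Q := integral_nonneg fun _ => by positivity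
  have hweight := rpow_max_le_mul_one_add_sq hr s
  have hfinish : ∀ k W : ℝ, 0 ≤ k → k ≤ K₀ + K₁ + 1 → r ^ (n - 1) * W ≤ (max 1 r) ^ (2 * s) →
      ∫⁻ x, ‖sphereExt r h x‖ₑ ^ 2 ∂μ ≤ ENNReal.ofReal (k * m * W * Q) →
      ENNReal.ofReal (r ^ (n - 1)) * ∫⁻ x, ‖sphereExt r h x‖ₑ ^ 2 ∂μ ≤
          ENNReal.ofReal ((K₀ + K₁ + 1) * max 1 (2 ^ (-s)) * m * ((1 + r ^ 2) ^ s * Q)) := by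
    intro k W hk0 hk hW hle
    calc _ ≤ ENNReal.ofReal (r ^ (n - 1)) * ENNReal.ofReal (k * m * W * Q) := by gcongr
      _ = ENNReal.ofReal (k * m * Q * (r ^ (n - 1) * W)) := by
          rw [← ENNReal.ofReal_mul (by positivity)]
          congr 1
          ring
      _ ≤ ENNReal.ofReal ((K₀ + K₁ + 1) * m * Q * (max 1 (2 ^ (-s)) * (1 + r ^ 2) ^ s)) := by
          apply ENNReal.ofReal_le_ofReal
          calc k * m * Q * (r ^ (n - 1) * W)
              ≤ k * m * Q * (max 1 (2 ^ (-s)) * (1 + r ^ 2) ^ s) :=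
                mul_le_mul_of_nonneg_left (hW.trans hweight) (by positivity)
            _ ≤ _ := by gcongr
      _ = _ := by congr 1; ring
  rcases le_or_gt r 1 with hr1 | hr1
  · refine hfinish K₀ 1 hK₀0 (by linarith) ?_ ?_
    · rw [max_eq_left hr1, Real.one_rpow, mul_one]
      exact pow_le_one₀ hr.le hr1
    · refine (lintegral_sphereExt_sq_le_trivial μ r hh).trans (ENNReal.ofReal_le_ofReal ?_)
      calc _ ≤ (4 ^ α * m) * (S * Q) := by gcongr
        _ = _ := by rw [hK₀]; ring
  · refine hfinish K₁ (r ^ (-β * (1 - δ))) hK₁0 (by linarith) ?_ ?_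
    · rw [max_eq_right hr1.le, ← Real.rpow_natCast, ← Real.rpow_add hr, hcast]
      apply Real.rpow_le_rpow_of_exponent_le hr1.le
      nlinarith
    · have hD : 0 ≤ C * m * r ^ (-β) := by positivity
      refine (lintegral_sphereExt_sq_le μ (R := r) hD (fun A _ => ?_) hM hδ0 hδ1 hh).trans_eq ?_
      · have hfr := frostman_restrict_le μ α A
        have hsuppA : μ.restrict A (Metric.ball (0 : E n) 4)ᶜ = 0 :=
          le_antisymm ((Measure.restrict_apply_le A _).trans_eq hsupp) zero_le
        refine (H (μ.restrict A) inferInstance hsuppA (hfr.trans_lt hfin) r hr1).trans ?_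
        have hfr' : (frostman (μ.restrict A) α).toReal ≤ m := ENNReal.toReal_mono hfin.ne hfr
        rw [Measure.restrict_apply_univ, ← measureReal_def]
        calc C * μ.real A * (frostman (μ.restrict A) α).toReal * r ^ (-β)
            ≤ C * μ.real A * m * r ^ (-β) := by gcongr
          _ = _ := by ring
      · congr 1
        have h1 : (16 * (C * m * r ^ (-β))) ^ (1 - δ) =
            (16 * C) ^ (1 - δ) * m ^ (1 - δ) * r ^ (-β * (1 - δ)) := by
          rw [← mul_assoc, ← mul_assoc, Real.mul_rpow (by positivity) (by positivity),
            Real.mul_rpow (by positivity) hm0, ← Real.rpow_mul hr.le]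
        have h2 : m = m ^ δ * m ^ (1 - δ) := by
          rw [← Real.rpow_add_of_nonneg hm0 hδ0.le (by linarith)]; simp
        rw [h1, Real.mul_rpow (by positivity) hm0, hK₁]
        conv_rhs => rw [h2]
        ring

lemma measurable_cosWave {n : ℕ} {f : E n → ℂ} (hf : Continuous (FT f)) :
    Measurable fun p : ℝ × E n => cosWave n f p.1 p.2 := by
  unfold cosWave
  refine (StronglyMeasurable.integral_prod_right' (f := fun q : (ℝ × E n) × E n =>
    ((Real.cos (2 * π * q.1.1 * ‖q.2‖ - ((n : ℝ) - 1) * π / 4) : ℝ) : ℂ) *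
    Complex.exp (((2 * π * ⟪q.1.2, q.2⟫ : ℝ) : ℂ) * Complex.I) * FT f q.2) ?_).measurable
  exact Continuous.stronglyMeasurable (by fun_prop)

/-- Integrating over `t` first and applying Plancherel reduces the space-time norm of the wave
to the `L²(μ)` norms of the extension operators. -/
lemma lintegral_cosWave_sq_le {n : ℕ} (hn : 0 < n) (μ : Measure (E n)) [IsFiniteMeasure μ]
    {f : E n → ℂ} (hf : Continuous (FT f)) (hfi : Integrable (FT f)) :
    ∫⁻ t : ℝ, ∫⁻ x, ‖cosWave n f t x‖ₑ ^ 2 ∂μ ≤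
      ∫⁻ r in Set.Ioi (0 : ℝ), ENNReal.ofReal (r ^ (n - 1)) * (ENNReal.ofReal (r ^ (n - 1)) *
        ∫⁻ x, ‖sphereExt r (fun ω => FT f (r • (ω : E n))) x‖ₑ ^ 2 ∂μ) := by
  have hms := measurable_sphereExt hf
  have hms2 : Measurable fun p : ℝ × E n =>
      ‖sphereExt p.1 (fun ω => FT f (p.1 • (ω : E n))) p.2‖ₑ ^ 2 := hms.enorm.pow_const 2
  have hmp : Measurable fun r : ℝ => ENNReal.ofReal (r ^ (n - 1)) ^ 2 :=
    (measurable_id.pow_const (n - 1)).ennreal_ofReal.pow_const 2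
  have hprod : Measurable fun p : ℝ × E n => ENNReal.ofReal (p.1 ^ (n - 1)) ^ 2 *
      ‖sphereExt p.1 (fun ω => FT f (p.1 • (ω : E n))) p.2‖ₑ ^ 2 :=
    (hmp.comp measurable_fst).mul hms2
  have hwave : Measurable fun p : ℝ × E n => ‖cosWave n f p.1 p.2‖ₑ ^ 2 :=
    (measurable_cosWave hf).enorm.pow_const 2
  rw [lintegral_lintegral_swap hwave.aemeasurable]
  calc ∫⁻ x, (∫⁻ t : ℝ, ‖cosWave n f t x‖ₑ ^ 2) ∂μ
      ≤ ∫⁻ x, (∫⁻ r, ‖radialProfile (FT f) x r‖ₑ ^ 2) ∂μ := by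
        refine lintegral_mono fun x => ?_
        simp only [cosWave_eq_radial hn f hfi]
        exact lintegral_cos_transform_sq_le (integrable_radialProfile hn hfi x) _
    _ = ∫⁻ x, (∫⁻ r in Set.Ioi (0 : ℝ), ENNReal.ofReal (r ^ (n - 1)) ^ 2 *
          ‖sphereExt r (fun ω => FT f (r • (ω : E n))) x‖ₑ ^ 2) ∂μ := by
        refine lintegral_congr fun x => ?_
        rw [← lintegral_indicator measurableSet_Ioi]
        refine lintegral_congr fun r => ?_
        by_cases hr : r ∈ Set.Ioi (0 : ℝ)
        · have hr' : 0 ≤ r ^ (n - 1) := pow_nonneg (le_of_lt hr) _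
          simp only [radialProfile, Set.indicator_of_mem hr]
          rw [enorm_mul, mul_pow, ← ofReal_norm (Complex.ofReal _), Complex.norm_real,
            Real.norm_of_nonneg hr']
        · simp [radialProfile, Set.indicator_of_notMem hr]
    _ = ∫⁻ r in Set.Ioi (0 : ℝ), ∫⁻ x, ENNReal.ofReal (r ^ (n - 1)) ^ 2 *
          ‖sphereExt r (fun ω => FT f (r • (ω : E n))) x‖ₑ ^ 2 ∂μ := by
        exact (lintegral_lintegral_swap hprod.aemeasurable).symm
    _ = _ := by
        refine lintegral_congr fun r => ?_
        rw [lintegral_const_mul' _ _ (ENNReal.pow_ne_top ENNReal.ofReal_ne_top), sq, mul_assoc]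

/-- spherical decay estimates for Fourier transforms of fractal measures imply
`L²` space-time estimates for solutions of the wave equation with fractal spatial measure. -/
theorem strichartz_from_spherical_decay (n : ℕ) (hn : 2 ≤ n) (α β : ℝ)
    (hα₀ : 0 < α) (hα₁ : α ≤ n) (hβ : 0 < β)
    (H : ∃ C : ℝ, 0 < C ∧
      ∀ (μ : Measure (E n)), IsFiniteMeasure μ →
        μ (Metric.ball (0 : E n) 4)ᶜ = 0 → frostman μ α < ⊤ →
        ∀ R : ℝ, 1 < R →
          (∫ ω : Metric.sphere (0 : E n) 1,
              ‖measFT μ (R • (ω : E n))‖ ^ 2 ∂(volume : Measure (E n)).toSphere) ≤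
            C * (μ Set.univ).toReal * (frostman μ α).toReal * R ^ (-β)) :
    ∀ s : ℝ, ((n : ℝ) - 1 - β) / 2 < s → ∃ C' : ℝ, 0 < C' ∧
      ∀ (μ : Measure (E n)), IsFiniteMeasure μ →
        μ.map (fun x => -x) = μ →
        μ (Metric.ball (0 : E n) 4)ᶜ = 0 → frostman μ α < ⊤ →
        ∀ (f : SchwartzMap (E n) ℂ), (∀ x, (f x).im = 0) → (∀ x, f (-x) = f x) →
          (∫ t : ℝ, ∫ x, ‖cosWave n (⇑f) t x‖ ^ 2 ∂μ) ≤
            C' * (frostman μ α).toReal * sobolevNorm (⇑f) s ^ 2 := by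
  intro s hs
  obtain ⟨C, hC, H⟩ := H
  have hn0 : 0 < n := by omega
  obtain ⟨K, hK, hbound⟩ := exists_sphereExt_bound hn0 hβ hC H hs
  refine ⟨K, hK, ?_⟩
  intro μ hμ _ hsupp hfin f _ _
  set m := (frostman μ α).toReal with hm
  have hm0 : 0 ≤ m := ENNReal.toReal_nonneg
  have hcont : Continuous (FT (⇑f)) := by rw [FT_eq_fourier]; exact SchwartzMap.continuous _
  have hint : Integrable (FT (⇑f)) := by rw [FT_eq_fourier]; exact SchwartzMap.integrable _
  have hsob : Integrable fun ξ : E n => (1 + ‖ξ‖ ^ 2) ^ s * ‖FT (⇑f) ξ‖ ^ 2 := by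
    rw [FT_eq_fourier]; exact integrable_sobolev_density _ s
  have hsob0 : ∀ ξ : E n, 0 ≤ (1 + ‖ξ‖ ^ 2) ^ s * ‖FT (⇑f) ξ‖ ^ 2 := fun ξ => by positivity
  have hnorm : sobolevNorm (⇑f) s ^ 2 = ∫ ξ : E n, (1 + ‖ξ‖ ^ 2) ^ s * ‖FT (⇑f) ξ‖ ^ 2 := by
    rw [sobolevNorm, ← Real.sqrt_eq_rpow, Real.sq_sqrt (integral_nonneg hsob0)]
  have hwcont : Continuous fun ξ : E n => (1 + ‖ξ‖ ^ 2) ^ s * ‖FT (⇑f) ξ‖ ^ 2 := by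
    refine Continuous.mul ?_ (hcont.norm.pow 2)
    exact Continuous.rpow_const (by fun_prop) fun ξ => Or.inl (by positivity)
  refine (ENNReal.ofReal_le_ofReal_iff (by positivity)).1 ?_
  calc ENNReal.ofReal (∫ t : ℝ, ∫ x, ‖cosWave n (⇑f) t x‖ ^ 2 ∂μ)
      ≤ ‖∫ t : ℝ, ∫ x, ‖cosWave n (⇑f) t x‖ ^ 2 ∂μ‖ₑ := Real.ofReal_le_enorm _
    _ ≤ ∫⁻ t : ℝ, ∫⁻ x, ‖cosWave n (⇑f) t x‖ₑ ^ 2 ∂μ := by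
        refine (enorm_integral_le_lintegral_enorm _).trans (lintegral_mono fun t => ?_)
        refine (enorm_integral_le_lintegral_enorm _).trans_eq (lintegral_congr fun x => ?_)
        rw [enorm_pow, enorm_norm]
    _ ≤ _ := lintegral_cosWave_sq_le hn0 μ hcont hint
    _ ≤ ∫⁻ r in Set.Ioi (0 : ℝ), ENNReal.ofReal (K * m) * (ENNReal.ofReal (r ^ (n - 1)) *
          ∫⁻ ω : sphere (0 : E n) 1, ENNReal.ofReal
            ((1 + ‖r • (ω : E n)‖ ^ 2) ^ s * ‖FT (⇑f) (r • (ω : E n))‖ ^ 2)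
            ∂(volume : Measure (E n)).toSphere) := by
        refine setLIntegral_mono' measurableSet_Ioi fun r hr => ?_
        have hr' : 0 < r := hr
        have hc : Continuous fun ω : sphere (0 : E n) 1 => FT (⇑f) (r • (ω : E n)) :=
          hcont.comp (by fun_prop)
        have hcw : Continuous fun ω : sphere (0 : E n) 1 =>
            (1 + ‖r • (ω : E n)‖ ^ 2) ^ s * ‖FT (⇑f) (r • (ω : E n))‖ ^ 2 :=
          hwcont.comp (by fun_prop : Continuous fun ω : sphere (0 : E n) 1 => r • (ω : E n))
        rw [mul_left_comm (ENNReal.ofReal (K * m))]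
        refine mul_le_mul_right ?_ _
        refine (hbound μ hμ hsupp hfin r hr' _ hc).trans_eq ?_
        rw [ENNReal.ofReal_mul (by positivity), ← integral_const_mul,
          ← ofReal_integral_eq_lintegral_ofReal (integrable_sphere hcw)
            (.of_forall fun ω => hsob0 _)]
        congr 3
        funext ω
        simp [norm_smul]
    _ = ENNReal.ofReal (K * m) * ∫⁻ ξ : E n,
          ENNReal.ofReal ((1 + ‖ξ‖ ^ 2) ^ s * ‖FT (⇑f) ξ‖ ^ 2) := by
        rw [lintegral_const_mul' _ _ ENNReal.ofReal_ne_top,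
          lintegral_polar hn0 hwcont.measurable.ennreal_ofReal]
    _ = ENNReal.ofReal (K * m * sobolevNorm (⇑f) s ^ 2) := by
        rw [← ofReal_integral_eq_lintegral_ofReal hsob (.of_forall hsob0), hnorm,
          ← ENNReal.ofReal_mul (by positivity)]
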